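/- Let (X, ρ, 𝒞) be a semi-Cartan graph with GRS Δ, Weyl groupoid 𝒲, and nil-Hecke algebra 𝒩 over a commutative ring 𝕂. The representation Λ : 𝒩 → End_𝕂(𝕂𝒲) determined by Λ(e^x) = E^x and Λ(n_i^x) = L_i^x is faithful, i.e. Λ is injective. -/

import Mathlib

open CategoryTheory

noncomputable section

namespace WeylGroupoid

variable {θ : ℕ} {X : Type} [Fintype X] [DecidableEq X]

/-- A *semi-Cartan graph*: a basic datum `(X, ρ)` together with a compatible bundle of
generalized Cartan matrices. -/
structure SCG (θ : ℕ) (X : Type) [Fintype X] [DecidableEq X] : Type where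
  nonempty : Nonempty X
  /-- the involutions `ρ_i` of the basic datum -/
  ρ : Fin θ → X → X
  invol : ∀ i x, ρ i (ρ i x) = x
  /-- the bundle of generalized Cartan matrices `C^x` -/
  C : X → Fin θ → Fin θ → ℤ
  diag : ∀ x i, C x i i = 2
  offdiag : ∀ x i j, i ≠ j → C x i j ≤ 0
  zero_iff : ∀ x i j, i ≠ j → (C x i j = 0 ↔ C x j i = 0)
  compat : ∀ x i j, C (ρ i x) i j = C x i j

/-- the simple root `α_i ∈ ℤ^θ` -/
def al (θ : ℕ) (i : Fin θ) : Fin θ → ℤ := Pi.single i 1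

/-- the reflection `s_i^x` of `ℤ^θ`, `s_i^x (α_j) = α_j - c^x_{ij} α_i` -/
def srefl (G : SCG θ X) (x : X) (i : Fin θ) (v : Fin θ → ℤ) : Fin θ → ℤ :=
  fun k => v k - (if k = i then ∑ j, G.C x i j * v j else 0)

/-- the cone `ℕ₀ α_i + ℕ₀ α_j` -/
def pairCone (θ : ℕ) (i j : Fin θ) : Set (Fin θ → ℤ) :=
  {v | ∃ a b : ℕ, v = (a : ℤ) • al θ i + (b : ℤ) • al θ j}

/-- A *generalized root system* on a semi-Cartan graph. -/
structure GRS (G : SCG θ X) : Type where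
  /-- the root sets `Δ^x` -/
  Δ : X → Set (Fin θ → ℤ)
  pos_neg : ∀ x, Δ x = (Δ x ∩ {v | ∀ k, 0 ≤ v k}) ∪ (-(Δ x ∩ {v | ∀ k, 0 ≤ v k}))
  simple : ∀ x i, Δ x ∩ {v | ∃ c : ℤ, v = c • al θ i} = {al θ i, -al θ i}
  reflect : ∀ x i, (srefl G x i) '' Δ x = Δ (G.ρ i x)
  pairFinite : ∀ x i j, (Δ x ∩ pairCone θ i j).Finite
  loop : ∀ x i j, (fun y => G.ρ i (G.ρ j y))^[(Δ x ∩ pairCone θ i j).ncard] x = x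

variable (G : SCG θ X)

/-- The entries `m^x_{ij} = |Δ^x ∩ (ℕ₀α_i + ℕ₀α_j)|`. -/
def mnum (R : GRS G) (x : X) (i j : Fin θ) : ℕ := (R.Δ x ∩ pairCone θ i j).ncard

/-- the set of positive roots `Δ^x_+` -/
def posRoots (R : GRS G) (x : X) : Set (Fin θ → ℤ) := R.Δ x ∩ {v | ∀ k, 0 ≤ v k}

/-- The objects of the Weyl groupoid (a type synonym for `X` carrying a quiver
structure depending on `G`). -/
def Obj (G : SCG θ X) : Type := X

instance : Quiver (Obj G) := ⟨fun a b => {i : Fin θ // G.ρ i (show X from b) = (show X from a)}⟩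

/-- objects of the path category -/
def pob (x : X) : Paths (Obj G) := (x : X)

/-- the generating arrow `σ_i^x : ρ_i(x) → x` -/
def genArrow (x : X) (i : Fin θ) : pob G (G.ρ i x) ⟶ pob G x :=
  Quiver.Path.nil.cons (⟨i, rfl⟩ : (show Obj G from G.ρ i x) ⟶ (show Obj G from x))

/-- the source of the word `σ_{i_1}^x σ_{i_2} ⋯ σ_{i_m}` (with target `x`) -/
def wsrc (G : SCG θ X) : List (Fin θ) → X → X
  | [], x => x
  | i :: l, x => wsrc G l (G.ρ i x)

/-- the path `σ_{i_1}^x σ_{i_2} ⋯ σ_{i_m} : wsrc(w,x) → x` in the free category -/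
def pathOf (G : SCG θ X) : (w : List (Fin θ)) → (x : X) → (pob G (wsrc G w x) ⟶ pob G x)
  | [], _ => 𝟙 _
  | i :: l, x => (pathOf G l (G.ρ i x)) ≫ genArrow G x i


/-- transport a path along an equality of sources -/
def castSrc {a b c : X} (h : a = b) (f : pob G a ⟶ pob G c) : pob G b ⟶ pob G c := by
  subst h; exact f

/-- the alternating word `[i, j, i, j, …]` of length `n` -/
def altWord (i j : Fin θ) : ℕ → List (Fin θ)
  | 0 => []
  | n + 1 => i :: altWord j i n

/-- The defining relations `(σ_i^x σ_j)^{m^x_{ij}} = id_x` of the Weyl groupoid. -/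
inductive wrel (R : GRS G) : HomRel (Paths (Obj G))
  | rel (x : X) (i j : Fin θ)
      (h : wsrc G (altWord i j (2 * mnum G R x i j)) x = x) :
      wrel R (castSrc G h (pathOf G (altWord i j (2 * mnum G R x i j)) x))
        (𝟙 (pob G x))

variable (R : GRS G)

/-- The Weyl groupoid, as the quotient of the free category on the quiver of the
`σ_i^x` by the relations `(σ_i^x σ_j)^{m^x_{ij}} = id_x` (every generator is invertible
in this quotient, so it is indeed a groupoid). -/
def W := CategoryTheory.Quotient (wrel G R)

instance : Category (W G R) := inferInstanceAs (Category (CategoryTheory.Quotient (wrel G R)))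

/-- objects of the Weyl groupoid -/
def objW (x : X) : W G R := ⟨pob G x⟩

/-- hom-sets `𝒲(y, x)` of the Weyl groupoid -/
def homW (y x : X) := objW G R y ⟶ objW G R x

instance {y x : X} : CoeSort (homW G R y x) (objW G R y ⟶ objW G R x) := ⟨id⟩

/-- the morphism of the Weyl groupoid defined by the word `σ_{i_1}^x ⋯ σ_{i_m}` -/
def morW (w : List (Fin θ)) (x : X) : homW G R (wsrc G w x) x :=
  (Quotient.functor (wrel G R)).map (pathOf G w x)

/-- the generator `σ_i^x : ρ_i(x) → x` in the Weyl groupoid -/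
def genW (x : X) (i : Fin θ) : homW G R (G.ρ i x) x :=
  (Quotient.functor (wrel G R)).map (genArrow G x i)

/-- transport a morphism of the Weyl groupoid along an equality of sources -/
def castW {a b c : X} (h : a = b) (f : homW G R a c) : homW G R b c := by
  subst h; exact f

/-- transport a morphism of the Weyl groupoid along an equality of targets -/
def castTgt {a c c' : X} (h : c = c') (f : homW G R a c) : homW G R a c' := by
  subst h; exact f

/-- the length `ℓ(f)` of a morphism of the Weyl groupoid -/
def len {y x : X} (f : homW G R y x) : ℕ :=
  sInf {n | ∃ w : List (Fin θ), w.length = n ∧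
    ∃ h : wsrc G w x = y, castW G R h (morW G R w x) = f}

/-- `w` is a reduced expression of the morphism `f ∈ 𝒲(y,x)` -/
def IsRedEx (w : List (Fin θ)) {y x : X} (f : homW G R y x) : Prop :=
  ∃ h : wsrc G w x = y, castW G R h (morW G R w x) = f ∧ w.length = len G R f


section NilHecke

variable (𝕂 : Type) [CommRing 𝕂]

/-- the generator `e^x` of the free algebra -/
def eF (x : X) : FreeAlgebra 𝕂 (X ⊕ X × Fin θ) := FreeAlgebra.ι 𝕂 (Sum.inl x)

/-- the generator `n_i^x` of the free algebra -/
def nF (x : X) (i : Fin θ) : FreeAlgebra 𝕂 (X ⊕ X × Fin θ) := FreeAlgebra.ι 𝕂 (Sum.inr (x, i))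

/-- the word `n_{i_1}^x n_{i_2} ⋯ n_{i_m}` in the free algebra
(superscripts determined by composability) -/
def nWF (G : SCG θ X) (𝕂 : Type) [CommRing 𝕂] :
    List (Fin θ) → X → FreeAlgebra 𝕂 (X ⊕ X × Fin θ)
  | [], _ => 1
  | i :: l, x => nF 𝕂 x i * nWF G 𝕂 l (G.ρ i x)

/-- The defining relations of the nil-Hecke algebra of `(X, ρ, 𝒞)`. -/
inductive nrel (R : GRS G) (𝕂 : Type) [CommRing 𝕂] :
    FreeAlgebra 𝕂 (X ⊕ X × Fin θ) → FreeAlgebra 𝕂 (X ⊕ X × Fin θ) → Prop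
  | orth (x y : X) (h : x ≠ y) : nrel R 𝕂 (eF 𝕂 x * eF 𝕂 y) 0
  | idem (x : X) : nrel R 𝕂 (eF 𝕂 x * eF 𝕂 x) (eF 𝕂 x)
  | total : nrel R 𝕂 (∑ x : X, eF 𝕂 x) 1
  | unit_right (x : X) (i : Fin θ) : nrel R 𝕂 (nF 𝕂 x i * eF 𝕂 (G.ρ i x)) (nF 𝕂 x i)
  | unit_left (x : X) (i : Fin θ) : nrel R 𝕂 (eF 𝕂 x * nF 𝕂 x i) (nF 𝕂 x i)
  | nil (x : X) (i : Fin θ) : nrel R 𝕂 (nF 𝕂 (G.ρ i x) i * nF 𝕂 x i) 0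
  | braid (x : X) (i j : Fin θ) (hij : i ≠ j) :
      nrel R 𝕂 (nWF G 𝕂 (altWord i j (mnum G R x i j)) x)
        (nWF G 𝕂 (altWord j i (mnum G R x i j)) x)

/-- The nil-Hecke algebra `𝒩(X, ρ, 𝒞)` of a Weyl groupoid over `𝕂`. -/
def NH := RingQuot (nrel G R 𝕂)

instance : Ring (NH G R 𝕂) := inferInstanceAs (Ring (RingQuot (nrel G R 𝕂)))
instance : Algebra 𝕂 (NH G R 𝕂) := inferInstanceAs (Algebra 𝕂 (RingQuot (nrel G R 𝕂)))

/-- the generator `e^x` of the nil-Hecke algebra -/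
def eN (x : X) : NH G R 𝕂 := RingQuot.mkAlgHom 𝕂 (nrel G R 𝕂) (eF 𝕂 x)

/-- the generator `n_i^x` of the nil-Hecke algebra -/
def nN (x : X) (i : Fin θ) : NH G R 𝕂 := RingQuot.mkAlgHom 𝕂 (nrel G R 𝕂) (nF 𝕂 x i)

/-- the word `n_{i_1}^x n_{i_2} ⋯ n_{i_m}` in the nil-Hecke algebra -/
def nW (w : List (Fin θ)) (x : X) : NH G R 𝕂 := RingQuot.mkAlgHom 𝕂 (nrel G R 𝕂) (nWF G 𝕂 w x)

/-- the set of morphisms of the Weyl groupoid -/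
def Mor := Σ (y : X) (x : X), homW G R y x

/-- the free `𝕂`-module `𝕂𝒲` on the set of morphisms of the Weyl groupoid -/
abbrev KW := Mor G R →₀ 𝕂

/-- the endomorphism `E^x` of `𝕂𝒲` -/
def Emap (x : X) : KW G R 𝕂 →ₗ[𝕂] KW G R 𝕂 :=
  Finsupp.lift (KW G R 𝕂) 𝕂 (Mor G R)
    (fun m => if m.2.1 = x then Finsupp.single m 1 else 0)

/-- the value of the endomorphism `L_i^x` of `𝕂𝒲` on a basis morphism -/
def Lval (x : X) (i : Fin θ) (m : Mor G R) : KW G R 𝕂 :=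
  if h : m.2.1 = G.ρ i x then
    (let f' : homW G R m.1 x := castTgt G R h m.2.2 ≫ genW G R x i
     if len G R m.2.2 < len G R f' then Finsupp.single ⟨m.1, x, f'⟩ 1 else 0)
  else 0

/-- the endomorphism `L_i^x` of `𝕂𝒲` -/
def Lmap (x : X) (i : Fin θ) : KW G R 𝕂 →ₗ[𝕂] KW G R 𝕂 :=
  Finsupp.lift (KW G R 𝕂) 𝕂 (Mor G R) (Lval G R 𝕂 x i)

end NilHecke

end WeylGroupoid

namespace WeylGroupoid

section Roots

variable {θ : ℕ} {X : Type} [Fintype X] [DecidableEq X] {G : SCG θ X} (R : GRS G)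

/-- The reflection `s_i^x` as a linear endomorphism of `ℤ^θ`. -/
def reflEnd (G : SCG θ X) (x : X) (i : Fin θ) : Module.End ℤ (Fin θ → ℤ) where
  toFun := srefl G x i
  map_add' u v := by
    funext k
    by_cases h : k = i
    · simp only [srefl, h, if_true, Pi.add_apply, mul_add, Finset.sum_add_distrib]; ring
    · simp [srefl, h]
  map_smul' c v := by
    funext k
    by_cases h : k = i
    · simp only [srefl, h, if_true, Pi.smul_apply, smul_eq_mul, RingHom.id_apply, mul_sub,
        Finset.mul_sum]
      congr 1
      exact Finset.sum_congr rfl fun j _ => by ring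
    · simp [srefl, h]

lemma reflEnd_apply (x : X) (i : Fin θ) (v : Fin θ → ℤ) :
    reflEnd G x i v = v - (∑ j, G.C x i j * v j) • al θ i := by
  funext k
  by_cases h : k = i
  · subst h; simp [reflEnd, srefl, al]
  · simp [reflEnd, srefl, al, h]

lemma reflEnd_apply_of_ne (x : X) {i k : Fin θ} (h : k ≠ i) (v : Fin θ → ℤ) :
    reflEnd G x i v k = v k := by
  simp [reflEnd, srefl, h]

lemma reflEnd_al (x : X) (i : Fin θ) : reflEnd G x i (al θ i) = -al θ i := by
  have h : ∑ j, G.C x i j * al θ i j = 2 := by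
    simp [al, Pi.single_apply, G.diag]
  rw [reflEnd_apply, h]
  module

lemma reflEnd_reflEnd (x : X) (i : Fin θ) (v : Fin θ → ℤ) :
    reflEnd G x i (reflEnd G x i v) = v := by
  rw [reflEnd_apply x i v, map_sub, map_smul, reflEnd_al, reflEnd_apply]
  module

lemma reflEnd_mul_self (x : X) (i : Fin θ) : reflEnd G x i * reflEnd G x i = 1 :=
  LinearMap.ext fun v => reflEnd_reflEnd x i v

lemma reflEnd_injective (x : X) (i : Fin θ) : Function.Injective (reflEnd G x i) :=
  Function.LeftInverse.injective (reflEnd_reflEnd x i)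

lemma reflEnd_rho (x : X) (i : Fin θ) : reflEnd G (G.ρ i x) i = reflEnd G x i := by
  refine LinearMap.ext fun v => ?_
  simp [reflEnd_apply, G.compat]

variable {R}

lemma reflEnd_mem {x : X} {v : Fin θ → ℤ} (i : Fin θ) (hv : v ∈ R.Δ x) :
    reflEnd G x i v ∈ R.Δ (G.ρ i x) := by
  rw [← R.reflect]
  exact ⟨v, hv, rfl⟩

lemma nonneg_or_nonpos {x : X} {v : Fin θ → ℤ} (hv : v ∈ R.Δ x) : 0 ≤ v ∨ v ≤ 0 := by
  rw [R.pos_neg] at hv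
  rcases hv with h | h
  · exact Or.inl h.2
  · right
    intro k
    have := h.2 k
    simp only [Pi.neg_apply] at this
    simpa using this

variable (R) in
lemma al_mem (x : X) (i : Fin θ) : al θ i ∈ R.Δ x := by
  have h : al θ i ∈ ({al θ i, -al θ i} : Set (Fin θ → ℤ)) := Or.inl rfl
  rw [← R.simple x i] at h
  exact h.1

lemma al_nonneg (i : Fin θ) : 0 ≤ al θ i := Pi.single_nonneg.2 zero_le_one

lemma al_ne_zero (i : Fin θ) : al θ i ≠ 0 := by simp [al]

lemma not_nonneg_neg_al (i : Fin θ) : ¬ 0 ≤ -al θ i := fun h => by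
  have := h i
  simp [al] at this

lemma eq_al_of_eq_smul {x : X} {v : Fin θ → ℤ} {i : Fin θ} (hv : v ∈ R.Δ x) (h0 : 0 ≤ v)
    (h : ∀ k, k ≠ i → v k = 0) : v = al θ i := by
  have hm : v ∈ R.Δ x ∩ {v | ∃ c : ℤ, v = c • al θ i} := by
    refine ⟨hv, v i, ?_⟩
    funext k
    by_cases hk : k = i
    · subst hk; simp [al]
    · simp [al, hk, h k hk]
  rw [R.simple] at hm
  rcases hm with h1 | h1
  · exact h1
  · rw [h1] at h0
    exact absurd h0 (not_nonneg_neg_al i)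

lemma ne_zero_of_mem {x : X} {v : Fin θ → ℤ} (i : Fin θ) (hv : v ∈ R.Δ x) : v ≠ 0 := by
  rintro rfl
  exact al_ne_zero i (eq_al_of_eq_smul hv le_rfl fun _ _ => rfl).symm

lemma reflEnd_nonneg {x : X} {v : Fin θ → ℤ} {i : Fin θ} (hv : v ∈ R.Δ x) (h0 : 0 ≤ v)
    (hne : v ≠ al θ i) : 0 ≤ reflEnd G x i v := by
  rcases nonneg_or_nonpos (reflEnd_mem i hv) with h | h
  · exact h
  · refine absurd (eq_al_of_eq_smul hv h0 fun k hk => ?_) hne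
    have h1 := h k
    rw [reflEnd_apply_of_ne x hk] at h1
    exact le_antisymm h1 (h0 k)

variable (R) in
/-- The positive roots at `x` which `f` does not map to a nonnegative vector. -/
def inversions (f : Module.End ℤ (Fin θ → ℤ)) (x : X) : Set (Fin θ → ℤ) :=
  {v | v ∈ R.Δ x ∧ 0 ≤ v ∧ ¬ 0 ≤ f v}

lemma inversions_mul_reflEnd_subset (f : Module.End ℤ (Fin θ → ℤ)) (x : X) (i : Fin θ) :
    inversions R (f * reflEnd G x i) x ⊆
      insert (al θ i) (reflEnd G x i '' inversions R f (G.ρ i x)) := by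
  rintro v ⟨hv, h0, hf⟩
  by_cases hne : v = al θ i
  · exact Or.inl hne
  · exact Or.inr ⟨reflEnd G x i v, ⟨reflEnd_mem i hv, reflEnd_nonneg hv h0 hne, hf⟩,
      reflEnd_reflEnd x i v⟩

/-- The endomorphism `w⁻¹ : Δ^x → Δ^y` attached to a word `w` with target `x` and source `y`. -/
def wordInv (G : SCG θ X) : List (Fin θ) → X → Module.End ℤ (Fin θ → ℤ)
  | [], _ => 1
  | i :: l, x => wordInv G l (G.ρ i x) * reflEnd G x i

lemma wordInv_mem (w : List (Fin θ)) (x : X) {v : Fin θ → ℤ} (hv : v ∈ R.Δ x) :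
    wordInv G w x v ∈ R.Δ (wsrc G w x) := by
  induction w generalizing x v with
  | nil => exact hv
  | cons i l ih => exact ih _ (reflEnd_mem i hv)

lemma wordInv_nonpos {w : List (Fin θ)} {x : X} {v : Fin θ → ℤ} (hv : v ∈ R.Δ x)
    (h : ¬ 0 ≤ wordInv G w x v) : wordInv G w x v ≤ 0 :=
  (nonneg_or_nonpos (wordInv_mem w x hv)).resolve_left h

lemma wordInv_cons_al (i : Fin θ) (l : List (Fin θ)) (x : X) :
    wordInv G (i :: l) x (al θ i) = -wordInv G l (G.ρ i x) (al θ i) := by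
  simp [wordInv, reflEnd_al]

lemma wsrc_append (w l : List (Fin θ)) (x : X) :
    wsrc G (w ++ l) x = wsrc G l (wsrc G w x) := by
  induction w generalizing x with
  | nil => rfl
  | cons i w ih => exact ih _

lemma wordInv_append (w l : List (Fin θ)) (x : X) :
    wordInv G (w ++ l) x = wordInv G l (wsrc G w x) * wordInv G w x := by
  induction w generalizing x with
  | nil => simp [wordInv, wsrc]
  | cons i w ih => simp [wordInv, wsrc, ih, mul_assoc]

lemma wsrc_reverse (w : List (Fin θ)) (x : X) : wsrc G w.reverse (wsrc G w x) = x := by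
  induction w generalizing x with
  | nil => rfl
  | cons i w ih => simp [wsrc, wsrc_append, ih, G.invol]

lemma wordInv_reverse_mul (w : List (Fin θ)) (x : X) :
    wordInv G w.reverse (wsrc G w x) * wordInv G w x = 1 := by
  induction w generalizing x with
  | nil => rfl
  | cons i w ih =>
    simp only [wsrc, List.reverse_cons, wordInv_append, wordInv, wsrc_reverse, reflEnd_rho, one_mul]
    calc _ = reflEnd G x i * (wordInv G w.reverse (wsrc G w (G.ρ i x)) * wordInv G w (G.ρ i x)) *
          reflEnd G x i := by simp only [mul_assoc]
      _ = 1 := by rw [ih, mul_one, reflEnd_mul_self]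

lemma wordInv_mul_reverse (w : List (Fin θ)) (x : X) :
    wordInv G w x * wordInv G w.reverse (wsrc G w x) = 1 := by
  have h := wordInv_reverse_mul (G := G) w.reverse (wsrc G w x)
  rwa [List.reverse_reverse, wsrc_reverse] at h

lemma encard_inversions_le (w : List (Fin θ)) (x : X) :
    (inversions R (wordInv G w x) x).encard ≤ w.length := by
  induction w generalizing x with
  | nil =>
    have h : inversions R (wordInv G [] x) x = ∅ :=
      Set.eq_empty_of_forall_notMem fun v hv => hv.2.2 hv.2.1
    simp [h]
  | cons i l ih =>
    calc _ ≤ _ := Set.encard_le_encard (inversions_mul_reflEnd_subset _ x i)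
      _ ≤ _ := Set.encard_insert_le _ _
      _ ≤ _ := by
        rw [(reflEnd_injective x i).encard_image, List.length_cons, Nat.cast_add, Nat.cast_one]
        gcongr
        exact ih _

variable (R) in
/-- A word is reduced if its length is its number of inversions. -/
def IsReducedWord (w : List (Fin θ)) (x : X) : Prop :=
  (inversions R (wordInv G w x) x).encard = w.length

lemma isReducedWord_nil (x : X) : IsReducedWord R [] x :=
  le_antisymm (encard_inversions_le _ _) (by simp)

lemma isReducedWord_cons {i : Fin θ} {l : List (Fin θ)} {x : X} :
    IsReducedWord R (i :: l) x ↔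
      IsReducedWord R l (G.ρ i x) ∧ 0 ≤ wordInv G l (G.ρ i x) (al θ i) := by
  have hle := encard_inversions_le (R := R) l (G.ρ i x)
  have hsub := inversions_mul_reflEnd_subset (R := R) (wordInv G l (G.ρ i x)) x i
  constructor
  · intro h
    have hcard : ((l.length : ℕ∞) + 1) = (inversions R (wordInv G (i :: l) x) x).encard := by
      rw [h]; simp
    constructor
    · refine le_antisymm hle ?_
      have h1 := (Set.encard_le_encard hsub).trans (Set.encard_insert_le _ _)
      rw [(reflEnd_injective x i).encard_image] at h1
      have h2 := hcard.le.trans h1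
      exact (ENat.add_le_add_iff_right ENat.one_ne_top).1 h2
    · by_contra hneg
      have h1 : inversions R (wordInv G (i :: l) x) x ⊆
          reflEnd G x i '' inversions R (wordInv G l (G.ρ i x)) (G.ρ i x) := by
        intro v hv
        rcases hsub hv with rfl | h'
        · refine absurd ?_ hv.2.2
          rw [wordInv_cons_al]
          exact neg_nonneg.2 (wordInv_nonpos (al_mem R _ i) hneg)
        · exact h'
      have h2 := Set.encard_le_encard h1
      rw [(reflEnd_injective x i).encard_image, ← hcard] at h2
      have h3 := h2.trans hle
      norm_cast at h3
      omega
  · rintro ⟨hl, hpos⟩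
    have hmem : al θ i ∉ reflEnd G x i '' inversions R (wordInv G l (G.ρ i x)) (G.ρ i x) := by
      rintro ⟨v, hv, hvi⟩
      have h1 : v = -al θ i := by
        rw [← reflEnd_reflEnd (G := G) x i v, hvi, reflEnd_al]
      exact not_nonneg_neg_al i (h1 ▸ hv.2.1)
    have heq : inversions R (wordInv G (i :: l) x) x =
        insert (al θ i) (reflEnd G x i '' inversions R (wordInv G l (G.ρ i x)) (G.ρ i x)) := by
      refine Set.Subset.antisymm hsub (Set.insert_subset ?_ ?_)
      · refine ⟨al_mem R x i, al_nonneg i, fun h => ?_⟩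
        rw [wordInv_cons_al] at h
        have h0 := le_antisymm (neg_nonneg.1 h) hpos
        exact ne_zero_of_mem i (wordInv_mem l _ (al_mem R _ i)) h0
      · rintro _ ⟨v, ⟨hv, h0, hf⟩, rfl⟩
        have hv' := reflEnd_mem i hv
        rw [G.invol, reflEnd_rho] at hv'
        refine ⟨hv', ?_, ?_⟩
        · rw [← reflEnd_rho]
          refine reflEnd_nonneg hv h0 ?_
          rintro rfl
          exact hf hpos
        · simpa [wordInv, reflEnd_reflEnd] using hf
    rw [IsReducedWord, heq, Set.encard_insert_of_notMem hmem, (reflEnd_injective x i).encard_image,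
      hl]
    simp

lemma IsReducedWord.of_append {w l : List (Fin θ)} {x : X} (h : IsReducedWord R (w ++ l) x) :
    IsReducedWord R l (wsrc G w x) := by
  induction w generalizing x with
  | nil => exact h
  | cons i w ih => exact ih (isReducedWord_cons.1 h).1

lemma IsReducedWord.not_nonneg {i : Fin θ} {l : List (Fin θ)} {x : X}
    (h : IsReducedWord R (i :: l) x) : ¬ 0 ≤ wordInv G (i :: l) x (al θ i) := fun h' => by
  rw [wordInv_cons_al] at h'
  exact ne_zero_of_mem i (wordInv_mem l _ (al_mem R _ i))
    (le_antisymm (neg_nonneg.1 h') (isReducedWord_cons.1 h).2)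

end Roots

section RankTwo

variable {θ : ℕ} {X : Type} [Fintype X] [DecidableEq X] {G : SCG θ X} {R : GRS G}

/-- The letter that follows `altWord i j n` in the infinite alternating word `i, j, i, j, …`. -/
def altLetter (i j : Fin θ) : ℕ → Fin θ
  | 0 => i
  | n + 1 => altLetter j i n

lemma altLetter_cases (i j : Fin θ) (n : ℕ) :
    (altLetter i j n = i ∧ altLetter j i n = j) ∨ (altLetter i j n = j ∧ altLetter j i n = i) := by
  induction n with
  | zero => exact Or.inl ⟨rfl, rfl⟩
  | succ n ih => simp only [altLetter]; tauto

lemma altWord_succ_eq_append (i j : Fin θ) (n : ℕ) :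
    altWord i j (n + 1) = altWord i j n ++ [altLetter i j n] := by
  induction n generalizing i j with
  | zero => rfl
  | succ n ih => rw [altWord, ih j i]; rfl

lemma length_altWord (i j : Fin θ) (n : ℕ) : (altWord i j n).length = n := by
  induction n generalizing i j with
  | zero => rfl
  | succ n ih => simp [altWord, ih]

lemma exists_altWord_eq_append (i j : Fin θ) {m n : ℕ} (h : m ≤ n) :
    ∃ l, altWord i j n = altWord i j m ++ l := by
  induction n, h using Nat.le_induction with
  | base => exact ⟨[], (List.append_nil _).symm⟩
  | succ n _ ih =>
    obtain ⟨l, hl⟩ := ih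
    exact ⟨l ++ [altLetter i j n], by rw [altWord_succ_eq_append, hl, List.append_assoc]⟩

lemma altLetter_two_mul (i j : Fin θ) (n : ℕ) : altLetter i j (2 * n) = i := by
  induction n with
  | zero => rfl
  | succ n ih => exact ih

lemma altWord_two_mul (i j : Fin θ) (n : ℕ) :
    altWord i j (2 * n) = altWord i j n ++ (altWord j i n).reverse := by
  induction n generalizing i j with
  | zero => rfl
  | succ n ih =>
    have h : altWord i j (2 * (n + 1)) = i :: altWord j i (2 * n + 1) := rfl
    rw [h, altWord_succ_eq_append, altLetter_two_mul, ih]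
    simp [altWord]

lemma wsrc_altWord_two_mul (i j : Fin θ) (n : ℕ) (x : X) :
    wsrc G (altWord i j (2 * n)) x = (fun y => G.ρ j (G.ρ i y))^[n] x := by
  induction n generalizing x with
  | zero => rfl
  | succ n ih => exact ih _

lemma pairCone_comm (i j : Fin θ) : pairCone θ i j = pairCone θ j i := by
  ext v
  constructor <;> rintro ⟨a, b, rfl⟩ <;> exact ⟨b, a, add_comm _ _⟩

lemma mnum_comm (x : X) (i j : Fin θ) : mnum G R x i j = mnum G R x j i := by
  rw [mnum, mnum, pairCone_comm]

lemma wsrc_altWord_loop (x : X) (i j : Fin θ) :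
    wsrc G (altWord i j (2 * mnum G R x i j)) x = x := by
  rw [wsrc_altWord_two_mul, mnum_comm]
  exact R.loop x j i

lemma wsrc_altWord_comm (x : X) (i j : Fin θ) :
    wsrc G (altWord i j (mnum G R x i j)) x = wsrc G (altWord j i (mnum G R x i j)) x := by
  have h := wsrc_altWord_loop (R := R) x i j
  rw [altWord_two_mul, wsrc_append] at h
  have h2 := wsrc_reverse (G := G) (altWord j i (mnum G R x i j)).reverse
    (wsrc G (altWord i j (mnum G R x i j)) x)
  rw [h, List.reverse_reverse] at h2
  exact h2.symm

lemma al_left_mem_pairCone (i j : Fin θ) : al θ i ∈ pairCone θ i j := ⟨1, 0, by simp⟩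

lemma al_right_mem_pairCone (i j : Fin θ) : al θ j ∈ pairCone θ i j := ⟨0, 1, by simp⟩

lemma eq_add_of_support {i j : Fin θ} (hij : i ≠ j) {v : Fin θ → ℤ}
    (h : ∀ k, k ≠ i → k ≠ j → v k = 0) : v = v i • al θ i + v j • al θ j := by
  funext k
  by_cases hi : k = i
  · subst hi; simp [al, hij]
  · by_cases hj : k = j
    · subst hj; simp [al, hi]
    · simp [al, hi, hj, h k hi hj]

lemma mem_pairCone_of_support {i j : Fin θ} (hij : i ≠ j) {v : Fin θ → ℤ} (h0 : 0 ≤ v)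
    (h : ∀ k, k ≠ i → k ≠ j → v k = 0) : v ∈ pairCone θ i j := by
  refine ⟨(v i).toNat, (v j).toNat, ?_⟩
  rw [Int.toNat_of_nonneg (h0 i), Int.toNat_of_nonneg (h0 j)]
  exact eq_add_of_support hij h

lemma support_of_mem_pairCone {i j : Fin θ} {v : Fin θ → ℤ} (h : v ∈ pairCone θ i j) {k : Fin θ}
    (hi : k ≠ i) (hj : k ≠ j) : v k = 0 := by
  obtain ⟨a, b, rfl⟩ := h
  simp [al, hi, hj]

lemma nonneg_of_mem_pairCone {i j : Fin θ} {v : Fin θ → ℤ} (h : v ∈ pairCone θ i j) : 0 ≤ v := by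
  obtain ⟨a, b, rfl⟩ := h
  exact add_nonneg (smul_nonneg (Int.natCast_nonneg a) (al_nonneg i))
    (smul_nonneg (Int.natCast_nonneg b) (al_nonneg j))

lemma map_nonneg_of_mem_pairCone {i j : Fin θ} {v : Fin θ → ℤ} (h : v ∈ pairCone θ i j)
    {f : Module.End ℤ (Fin θ → ℤ)} (hi : 0 ≤ f (al θ i)) (hj : 0 ≤ f (al θ j)) : 0 ≤ f v := by
  obtain ⟨a, b, rfl⟩ := h
  rw [map_add, map_smul, map_smul]
  exact add_nonneg (smul_nonneg (Int.natCast_nonneg a) hi) (smul_nonneg (Int.natCast_nonneg b) hj)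

lemma encard_pairRoots (x : X) (i j : Fin θ) :
    (R.Δ x ∩ pairCone θ i j).encard = mnum G R x i j :=
  ((R.pairFinite x i j).cast_ncard_eq).symm

lemma mnum_le_length {x : X} {i j : Fin θ} {w : List (Fin θ)}
    (hi : ¬ 0 ≤ wordInv G w x (al θ i)) (hj : ¬ 0 ≤ wordInv G w x (al θ j)) :
    mnum G R x i j ≤ w.length := by
  have hsub : R.Δ x ∩ pairCone θ i j ⊆ inversions R (wordInv G w x) x := by
    rintro v ⟨hv, hc⟩
    refine ⟨hv, nonneg_of_mem_pairCone hc, fun h0 => ?_⟩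
    have h1 : 0 ≤ (-wordInv G w x) v := map_nonneg_of_mem_pairCone hc
      (neg_nonneg.2 (wordInv_nonpos (al_mem R x i) hi))
      (neg_nonneg.2 (wordInv_nonpos (al_mem R x j) hj))
    exact ne_zero_of_mem i (wordInv_mem w x hv) (le_antisymm (neg_nonneg.1 h1) h0)
  have h := (Set.encard_le_encard hsub).trans (encard_inversions_le w x)
  rw [encard_pairRoots] at h
  exact_mod_cast h

lemma mnum_rho_le (x : X) {i j : Fin θ} (hij : i ≠ j) :
    mnum G R (G.ρ i x) i j ≤ mnum G R x i j := by
  have hsub : R.Δ (G.ρ i x) ∩ pairCone θ i j ⊆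
      insert (al θ i) (reflEnd G x i '' ((R.Δ x ∩ pairCone θ i j) \ {al θ i})) := by
    rintro v ⟨hv, hc⟩
    by_cases hne : v = al θ i
    · exact Or.inl hne
    · refine Or.inr ⟨reflEnd G x i v, ⟨⟨?_, ?_⟩, ?_⟩, reflEnd_reflEnd x i v⟩
      · have h := reflEnd_mem i hv
        rwa [G.invol, reflEnd_rho] at h
      · refine mem_pairCone_of_support hij ?_ fun k hi hj => ?_
        · rw [← reflEnd_rho]
          exact reflEnd_nonneg hv (nonneg_of_mem_pairCone hc) hne
        · rw [reflEnd_apply_of_ne x hi, support_of_mem_pairCone hc hi hj]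
      · intro h
        have h1 : v = -al θ i := by
          rw [← reflEnd_reflEnd (G := G) x i v, Set.mem_singleton_iff.1 h, reflEnd_al]
        exact not_nonneg_neg_al i (h1 ▸ nonneg_of_mem_pairCone hc)
  have h := (Set.encard_le_encard hsub).trans (Set.encard_insert_le _ _)
  rw [(reflEnd_injective x i).encard_image,
    Set.encard_sdiff_singleton_add_one (Set.mem_inter (al_mem R x i) (al_left_mem_pairCone i j)),
    encard_pairRoots, encard_pairRoots] at h
  exact_mod_cast h

lemma mnum_rho (x : X) {i j : Fin θ} (hij : i ≠ j) :
    mnum G R (G.ρ i x) i j = mnum G R x i j := by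
  refine le_antisymm (mnum_rho_le x hij) ?_
  have h := mnum_rho_le (R := R) (G.ρ i x) hij
  rwa [G.invol] at h

lemma two_le_mnum (x : X) {i j : Fin θ} (hij : i ≠ j) : 2 ≤ mnum G R x i j := by
  have hne : al θ i ≠ al θ j := fun h => by
    have := congrFun h i
    simp [al, hij] at this
  have hsub : ({al θ i, al θ j} : Set (Fin θ → ℤ)) ⊆ R.Δ x ∩ pairCone θ i j := by
    rintro v (rfl | rfl)
    · exact ⟨al_mem R x i, al_left_mem_pairCone i j⟩
    · exact ⟨al_mem R x j, al_right_mem_pairCone i j⟩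
  have h := Set.encard_le_encard hsub
  rw [Set.encard_pair hne, encard_pairRoots] at h
  exact_mod_cast h

lemma isReducedWord_altWord (x : X) {i j : Fin θ} (hij : i ≠ j) {n : ℕ}
    (hn : n ≤ mnum G R x i j) : IsReducedWord R (altWord i j n) x := by
  induction n generalizing x i j with
  | zero => exact isReducedWord_nil x
  | succ n ih =>
    have hm : mnum G R (G.ρ i x) j i = mnum G R x i j := by rw [mnum_comm, mnum_rho x hij]
    have hred : IsReducedWord R (altWord j i n) (G.ρ i x) := ih _ hij.symm (by omega)
    refine isReducedWord_cons.2 ⟨hred, ?_⟩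
    by_contra hneg
    cases n with
    | zero => exact hneg (al_nonneg i)
    | succ n =>
      have h := (mnum_le_length (R := R) hred.not_nonneg hneg).trans_eq
        (length_altWord j i (n + 1))
      omega

lemma wordInv_altWord_apply (i j : Fin θ) (n : ℕ) (x : X) (v : Fin θ → ℤ) {k : Fin θ}
    (hi : k ≠ i) (hj : k ≠ j) : wordInv G (altWord i j n) x v k = v k := by
  induction n generalizing i j x v with
  | zero => rfl
  | succ n ih =>
    exact (ih j i _ _ hj hi).trans (reflEnd_apply_of_ne x hi v)

lemma wordInv_altWord_reverse_apply (i j : Fin θ) (n : ℕ) (x : X) (v : Fin θ → ℤ) {k : Fin θ}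
    (hi : k ≠ i) (hj : k ≠ j) :
    wordInv G (altWord i j n).reverse (wsrc G (altWord i j n) x) v k = v k := by
  have h := wordInv_altWord_apply (G := G) i j n x
    (wordInv G (altWord i j n).reverse (wsrc G (altWord i j n) x) v) hi hj
  rw [← h, ← Module.End.mul_apply, wordInv_mul_reverse, Module.End.one_apply]

lemma inversions_altWord (x : X) {i j : Fin θ} (hij : i ≠ j) :
    inversions R (wordInv G (altWord i j (mnum G R x i j)) x) x = R.Δ x ∩ pairCone θ i j := by
  have hfin : (inversions R (wordInv G (altWord i j (mnum G R x i j)) x) x).Finite :=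
    Set.finite_of_encard_le_coe (encard_inversions_le _ x)
  refine hfin.eq_of_subset_of_encard_le ?_ ?_
  · rintro v ⟨hv, h0, hf⟩
    refine ⟨hv, mem_pairCone_of_support hij h0 fun k hi hj => le_antisymm ?_ (h0 k)⟩
    rw [← wordInv_altWord_apply (G := G) i j (mnum G R x i j) x v hi hj]
    exact wordInv_nonpos hv hf k
  · rw [encard_pairRoots, isReducedWord_altWord x hij le_rfl, length_altWord]

lemma wordInv_altWord_al_right (x : X) {i j : Fin θ} (hij : i ≠ j) {n : ℕ}
    (hn : n + 1 = mnum G R x i j) :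
    wordInv G (altWord i j n) x (al θ j) = al θ (altLetter i j n) := by
  have h2 := two_le_mnum (R := R) x hij
  have hpos : 0 ≤ wordInv G (altWord i j n) x (al θ j) := by
    by_contra hneg
    obtain ⟨k, rfl⟩ : ∃ k, n = k + 1 := ⟨n - 1, by omega⟩
    have hred := isReducedWord_altWord (R := R) x hij (n := k + 1) (by omega)
    have h := (mnum_le_length (R := R) hred.not_nonneg hneg).trans_eq
      (length_altWord i j (k + 1))
    omega
  have hinv : al θ j ∈ inversions R (wordInv G (altWord i j (n + 1)) x) x := by
    rw [hn, inversions_altWord x hij]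
    exact ⟨al_mem R x j, al_right_mem_pairCone i j⟩
  by_contra hne
  refine hinv.2.2 ?_
  rw [altWord_succ_eq_append, wordInv_append]
  simpa [wordInv] using reflEnd_nonneg (wordInv_mem _ x (al_mem R x j)) hpos hne

lemma wordInv_altWord_mnum_al_right (x : X) {i j : Fin θ} (hij : i ≠ j) {n : ℕ}
    (hn : n + 1 = mnum G R x i j) :
    wordInv G (altWord i j (n + 1)) x (al θ j) = -al θ (altLetter i j n) := by
  rw [altWord_succ_eq_append, wordInv_append, Module.End.mul_apply,
    wordInv_altWord_al_right x hij hn]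
  simp [wordInv, reflEnd_al]

lemma wordInv_altWord_mnum_al_left (x : X) {i j : Fin θ} (hij : i ≠ j) {n : ℕ}
    (hn : n + 1 = mnum G R x i j) :
    wordInv G (altWord i j (n + 1)) x (al θ i) = -al θ (altLetter j i n) := by
  rw [altWord, wordInv_cons_al, wordInv_altWord_al_right (R := R) (G.ρ i x) hij.symm]
  rw [hn, mnum_comm (G.ρ i x), mnum_rho x hij]

/-- Both `T` and its inverse send `α_k` to a root of the form `α_k + aα_i + bα_j`, and the
coefficients `a`, `b` are nonnegative in both cases. -/
lemma eq_one_of_fix_pair {x : X} {i j : Fin θ} (hij : i ≠ j) {T T' : Module.End ℤ (Fin θ → ℤ)}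
    (hTT' : T' * T = 1) (hT : ∀ v ∈ R.Δ x, T v ∈ R.Δ x) (hT' : ∀ v ∈ R.Δ x, T' v ∈ R.Δ x)
    (hTk : ∀ v k, k ≠ i → k ≠ j → T v k = v k) (hTk' : ∀ v k, k ≠ i → k ≠ j → T' v k = v k)
    (hi : T (al θ i) = al θ i) (hj : T (al θ j) = al θ j) : T = 1 := by
  have hinv : ∀ v, T' (T v) = v := fun v => LinearMap.congr_fun hTT' v
  have hi' : T' (al θ i) = al θ i := by conv_lhs => rw [← hi, hinv]
  have hj' : T' (al θ j) = al θ j := by conv_lhs => rw [← hj, hinv]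
  have key : ∀ S : Module.End ℤ (Fin θ → ℤ), (∀ v ∈ R.Δ x, S v ∈ R.Δ x) →
      (∀ v k, k ≠ i → k ≠ j → S v k = v k) → ∀ k, k ≠ i → k ≠ j → al θ k ≤ S (al θ k) := by
    intro S hS hSk k hki hkj
    have h0 : 0 ≤ S (al θ k) := by
      rcases nonneg_or_nonpos (hS _ (al_mem R x k)) with h | h
      · exact h
      · have h1 := h k
        rw [hSk _ k hki hkj] at h1
        simp [al] at h1
    intro l
    by_cases hli : l = i
    · subst hli
      simpa [al, Ne.symm hki] using h0 l
    · by_cases hlj : l = j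
      · subst hlj
        simpa [al, Ne.symm hkj] using h0 l
      · exact (hSk _ l hli hlj).ge
  have hal : ∀ k, T (al θ k) = al θ k := by
    intro k
    by_cases hki : k = i
    · rw [hki, hi]
    by_cases hkj : k = j
    · rw [hkj, hj]
    have h1 := key T hT hTk k hki hkj
    have h2 := key T' hT' hTk' k hki hkj
    set β := T (al θ k) - al θ k with hβ
    have hfix : T' β = β := by
      have hs := eq_add_of_support hij (v := β) fun l hli hlj => by
        rw [hβ, Pi.sub_apply, hTk _ l hli hlj, sub_self]
      rw [hs, map_add, map_smul, map_smul, hi', hj']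
    have h3 : β = al θ k - T' (al θ k) := by
      rw [← hfix, hβ, map_sub, hinv]
    refine le_antisymm ?_ h1
    rw [← sub_nonpos, ← hβ, h3]
    exact sub_nonpos.2 h2
  refine (Pi.basisFun ℤ (Fin θ)).ext fun k => ?_
  simpa [al] using hal k

lemma wordInv_altWord_comm (x : X) {i j : Fin θ} (hij : i ≠ j) :
    wordInv G (altWord i j (mnum G R x i j)) x = wordInv G (altWord j i (mnum G R x i j)) x := by
  obtain ⟨n, hn⟩ : ∃ n, n + 1 = mnum G R x i j :=
    ⟨mnum G R x i j - 1, by have := two_le_mnum (R := R) x hij; omega⟩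
  have hn' : n + 1 = mnum G R x j i := by rw [hn, mnum_comm]
  have hsrc : wsrc G (altWord i j (n + 1)) x = wsrc G (altWord j i (n + 1)) x := by
    rw [hn]; exact wsrc_altWord_comm x i j
  rw [← hn]
  set f := wordInv G (altWord i j (n + 1)) x with hf
  set f' := wordInv G (altWord j i (n + 1)) x with hf'
  set g := wordInv G (altWord i j (n + 1)).reverse (wsrc G (altWord i j (n + 1)) x) with hg
  set g' := wordInv G (altWord j i (n + 1)).reverse (wsrc G (altWord j i (n + 1)) x) with hg'
  have hgf' : g' * f' = 1 := wordInv_reverse_mul _ _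
  have hfg : f * g = 1 := wordInv_mul_reverse _ _
  have hgf : g * f = 1 := wordInv_reverse_mul _ _
  have hfg' : f' * g' = 1 := wordInv_mul_reverse _ _
  have hfi : f (al θ i) = f' (al θ i) := by
    rw [hf, hf', wordInv_altWord_mnum_al_left x hij hn,
      wordInv_altWord_mnum_al_right x hij.symm hn']
  have hfj : f (al θ j) = f' (al θ j) := by
    rw [hf, hf', wordInv_altWord_mnum_al_right x hij hn,
      wordInv_altWord_mnum_al_left x hij.symm hn']
  have hone : g' * f = 1 := by
    refine eq_one_of_fix_pair (R := R) (x := x) hij (T' := g * f') ?_ ?_ ?_ ?_ ?_ ?_ ?_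
    · rw [mul_assoc, ← mul_assoc f', hfg', one_mul, hgf]
    · intro v hv
      have h := wordInv_mem (altWord i j (n + 1)) x hv
      rw [hsrc] at h
      have h' := wordInv_mem (altWord j i (n + 1)).reverse _ h
      rw [wsrc_reverse] at h'
      exact h'
    · intro v hv
      have h := wordInv_mem (altWord j i (n + 1)) x hv
      rw [← hsrc] at h
      have h' := wordInv_mem (altWord i j (n + 1)).reverse _ h
      rw [wsrc_reverse] at h'
      exact h'
    · intro v k hi hj
      exact (wordInv_altWord_reverse_apply j i _ x _ hj hi).trans
        (wordInv_altWord_apply i j _ x v hi hj)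
    · intro v k hi hj
      exact (wordInv_altWord_reverse_apply i j _ x _ hi hj).trans
        (wordInv_altWord_apply j i _ x v hj hi)
    · rw [Module.End.mul_apply, hfi, ← Module.End.mul_apply, hgf', Module.End.one_apply]
    · rw [Module.End.mul_apply, hfj, ← Module.End.mul_apply, hgf', Module.End.one_apply]
  calc f = f' * (g' * f) := by rw [← mul_assoc, hfg', one_mul]
    _ = f' := by rw [hone, mul_one]

lemma wordInv_altWord_loop (x : X) (i j : Fin θ) :
    wordInv G (altWord i j (2 * mnum G R x i j)) x = 1 := by
  rw [altWord_two_mul, wordInv_append]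
  by_cases hij : i = j
  · subst hij
    exact wordInv_reverse_mul _ _
  · rw [wordInv_altWord_comm x hij, wsrc_altWord_comm, wordInv_reverse_mul]

end RankTwo

section Matsumoto

variable {θ : ℕ} {X : Type} [Fintype X] [DecidableEq X] {G : SCG θ X} {R : GRS G}
  {𝕂 : Type} [CommRing 𝕂]

lemma nN_mul_nN (x : X) (i : Fin θ) : nN G R 𝕂 x i * nN G R 𝕂 (G.ρ i x) i = 0 := by
  have h := RingQuot.mkAlgHom_rel 𝕂 (nrel.nil (R := R) (𝕂 := 𝕂) (G.ρ i x) i)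
  rw [map_mul, map_zero, G.invol] at h
  exact h

lemma eN_mul_eN_self (x : X) : eN G R 𝕂 x * eN G R 𝕂 x = eN G R 𝕂 x := by
  have h := RingQuot.mkAlgHom_rel 𝕂 (nrel.idem (R := R) (𝕂 := 𝕂) x)
  rw [map_mul] at h
  exact h

lemma eN_mul_eN_of_ne {x y : X} (hxy : x ≠ y) : eN G R 𝕂 x * eN G R 𝕂 y = 0 := by
  have h := RingQuot.mkAlgHom_rel 𝕂 (nrel.orth (R := R) (𝕂 := 𝕂) x y hxy)
  rw [map_mul, map_zero] at h
  exact h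

lemma sum_eN : ∑ x, eN G R 𝕂 x = 1 := by
  have h := RingQuot.mkAlgHom_rel 𝕂 (nrel.total (R := R) (𝕂 := 𝕂))
  rw [map_sum, map_one] at h
  exact h

lemma nN_mul_eN (x : X) (i : Fin θ) : nN G R 𝕂 x i * eN G R 𝕂 (G.ρ i x) = nN G R 𝕂 x i := by
  have h := RingQuot.mkAlgHom_rel 𝕂 (nrel.unit_right (R := R) (𝕂 := 𝕂) x i)
  rw [map_mul] at h
  exact h

lemma eN_mul_nN (x : X) (i : Fin θ) : eN G R 𝕂 x * nN G R 𝕂 x i = nN G R 𝕂 x i := by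
  have h := RingQuot.mkAlgHom_rel 𝕂 (nrel.unit_left (R := R) (𝕂 := 𝕂) x i)
  rw [map_mul] at h
  exact h

lemma nW_nil (x : X) : nW G R 𝕂 [] x = 1 := map_one _

lemma nW_cons (i : Fin θ) (l : List (Fin θ)) (x : X) :
    nW G R 𝕂 (i :: l) x = nN G R 𝕂 x i * nW G R 𝕂 l (G.ρ i x) := map_mul _ _ _

lemma nW_append (w l : List (Fin θ)) (x : X) :
    nW G R 𝕂 (w ++ l) x = nW G R 𝕂 w x * nW G R 𝕂 l (wsrc G w x) := by
  induction w generalizing x with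
  | nil => rw [nW_nil, one_mul]; rfl
  | cons i w ih => rw [List.cons_append, nW_cons, nW_cons, ih, mul_assoc]; rfl

variable (R 𝕂) in
/-- Two words with target `x` agree in every respect that is invariant under braid moves. -/
structure WordEquiv (x : X) (w w' : List (Fin θ)) : Prop where
  wsrc_eq : wsrc G w x = wsrc G w' x
  length_eq : w.length = w'.length
  wordInv_eq : wordInv G w x = wordInv G w' x
  nW_eq : nW G R 𝕂 w x = nW G R 𝕂 w' x

namespace WordEquiv

variable {x : X} {w w' w'' : List (Fin θ)}

lemma refl (x : X) (w : List (Fin θ)) : WordEquiv R 𝕂 x w w := ⟨rfl, rfl, rfl, rfl⟩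

lemma trans (h : WordEquiv R 𝕂 x w w') (h' : WordEquiv R 𝕂 x w' w'') : WordEquiv R 𝕂 x w w'' :=
  ⟨h.1.trans h'.1, h.2.trans h'.2, h.3.trans h'.3, h.4.trans h'.4⟩

lemma append_right (h : WordEquiv R 𝕂 x w w') (l : List (Fin θ)) :
    WordEquiv R 𝕂 x (w ++ l) (w' ++ l) where
  wsrc_eq := by rw [wsrc_append, wsrc_append, h.wsrc_eq]
  length_eq := by simp [h.length_eq]
  wordInv_eq := by rw [wordInv_append, wordInv_append, h.wordInv_eq, h.wsrc_eq]
  nW_eq := by rw [nW_append, nW_append, h.nW_eq, h.wsrc_eq]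

lemma append_left (l : List (Fin θ)) (h : WordEquiv R 𝕂 (wsrc G l x) w w') :
    WordEquiv R 𝕂 x (l ++ w) (l ++ w') where
  wsrc_eq := by rw [wsrc_append, wsrc_append, h.wsrc_eq]
  length_eq := by simp [h.length_eq]
  wordInv_eq := by rw [wordInv_append, wordInv_append, h.wordInv_eq]
  nW_eq := by rw [nW_append, nW_append, h.nW_eq]

lemma braid (x : X) {i j : Fin θ} (hij : i ≠ j) :
    WordEquiv R 𝕂 x (altWord i j (mnum G R x i j)) (altWord j i (mnum G R x i j)) where
  wsrc_eq := wsrc_altWord_comm x i j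
  length_eq := by rw [length_altWord, length_altWord]
  wordInv_eq := wordInv_altWord_comm x hij
  nW_eq := RingQuot.mkAlgHom_rel 𝕂 (nrel.braid x i j hij)

lemma isReducedWord (h : WordEquiv R 𝕂 x w w') (hw : IsReducedWord R w x) :
    IsReducedWord R w' x := by
  rwa [IsReducedWord, ← h.wordInv_eq, ← h.length_eq]

end WordEquiv

variable (R 𝕂) in
/-- The exchange property: if `w⁻¹` maps `α_i` to a negative root, then some word braid equivalent
to the reduced word `w` starts with `i`. -/
theorem exists_wordEquiv_cons {w : List (Fin θ)} {x : X} {i : Fin θ} (hw : IsReducedWord R w x)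
    (hi : ¬ 0 ≤ wordInv G w x (al θ i)) : ∃ u, WordEquiv R 𝕂 x w (i :: u) := by
  induction hn : w.length using Nat.strong_induction_on generalizing w x i with
  | _ n ih =>
  cases w with
  | nil => exact absurd (al_nonneg i) hi
  | cons j u =>
  by_cases hij : j = i
  · subst hij; exact ⟨u, WordEquiv.refl _ _⟩
  let P : ℕ → Prop := fun k => ∃ u', WordEquiv R 𝕂 x (j :: u) (altWord j i k ++ u')
  have hP1 : P 1 := ⟨u, WordEquiv.refl _ _⟩
  have hPle : ∀ k, P k → k ≤ n := by
    rintro k ⟨u', h⟩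
    have h1 := h.length_eq
    rw [hn, List.length_append, length_altWord] at h1
    omega
  classical
  obtain ⟨k, ⟨u', hu'⟩, hk1, hmax⟩ : ∃ k, P k ∧ 1 ≤ k ∧ ¬ P (k + 1) := by
    refine ⟨Nat.findGreatest P n, Nat.findGreatest_spec (hPle 1 hP1) hP1,
      Nat.le_findGreatest (hPle 1 hP1) hP1, fun h => ?_⟩
    have h1 := Nat.le_findGreatest (hPle _ h) h
    omega
  set y := wsrc G (altWord j i k) x with hy
  have hred : IsReducedWord R (altWord j i k ++ u') x := hu'.isReducedWord hw
  have hred' : IsReducedWord R u' y := hred.of_append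
  have hnext : 0 ≤ wordInv G u' y (al θ (altLetter j i k)) := by
    by_contra hneg
    have hlt : u'.length < n := by
      have h1 := hu'.length_eq
      rw [hn, List.length_append, length_altWord] at h1
      omega
    obtain ⟨v, hv⟩ := ih _ hlt hred' hneg rfl
    refine hmax ⟨v, hu'.trans ?_⟩
    rw [altWord_succ_eq_append, List.append_assoc]
    exact WordEquiv.append_left _ hv
  have hprev : 0 ≤ wordInv G u' y (al θ (altLetter i j k)) := by
    obtain ⟨l, rfl⟩ : ∃ l, k = l + 1 := ⟨k - 1, by omega⟩
    have h1 := hred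
    rw [altWord_succ_eq_append, List.append_assoc] at h1
    have h2 := (isReducedWord_cons.1 h1.of_append).2
    have hy' : y = G.ρ (altLetter j i l) (wsrc G (altWord j i l) x) := by
      rw [hy, altWord_succ_eq_append, wsrc_append]; rfl
    rw [hy']
    exact h2
  have hpos : 0 ≤ wordInv G u' y (al θ j) ∧ 0 ≤ wordInv G u' y (al θ i) := by
    rcases altLetter_cases j i k with ⟨h1, h2⟩ | ⟨h1, h2⟩ <;> rw [h1] at hnext <;> rw [h2] at hprev
    · exact ⟨hnext, hprev⟩
    · exact ⟨hprev, hnext⟩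
  have hneg : ∀ a, a = j ∨ a = i → ¬ 0 ≤ wordInv G (j :: u) x (al θ a) →
      ¬ 0 ≤ wordInv G (altWord j i k) x (al θ a) := by
    intro a ha hna h0
    refine hna ?_
    rw [hu'.wordInv_eq, wordInv_append, Module.End.mul_apply]
    refine map_nonneg_of_mem_pairCone (mem_pairCone_of_support hij h0 fun c hcj hci => ?_)
      hpos.1 hpos.2
    rw [wordInv_altWord_apply j i k x _ hcj hci]
    rcases ha with rfl | rfl
    · simp [al, hcj]
    · simp [al, hci]
  have hm : mnum G R x j i ≤ k :=
    (mnum_le_length (hneg j (Or.inl rfl) hw.not_nonneg) (hneg i (Or.inr rfl) hi)).trans_eq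
      (length_altWord j i k)
  obtain ⟨l, hl⟩ := exists_altWord_eq_append j i hm
  have hb := ((WordEquiv.braid (𝕂 := 𝕂) (R := R) x hij).append_right l).append_right u'
  rw [← hl] at hb
  obtain ⟨m, hm'⟩ : ∃ m, mnum G R x j i = m + 1 :=
    ⟨mnum G R x j i - 1, by have := two_le_mnum (R := R) x hij; omega⟩
  rw [hm'] at hb
  exact ⟨_, hu'.trans hb⟩

/-- Matsumoto's theorem for the nil-Hecke algebra: the element attached to a reduced word only
depends on the target and on the linear map of the word. -/
theorem nW_eq_of_wordInv_eq {w w' : List (Fin θ)} {x : X} (hw : IsReducedWord R w x)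
    (hw' : IsReducedWord R w' x) (h : wordInv G w x = wordInv G w' x) :
    nW G R 𝕂 w x = nW G R 𝕂 w' x := by
  induction w' generalizing w x with
  | nil =>
    have h1 : (w.length : ℕ∞) = 0 := by
      rw [← hw, h, hw']; rfl
    rw [List.length_eq_zero_iff.1 (show w.length = 0 by exact_mod_cast h1)]
  | cons i l ih =>
    obtain ⟨u, hu⟩ := exists_wordEquiv_cons R 𝕂 hw (i := i) (by rw [h]; exact hw'.not_nonneg)
    have hlin : wordInv G u (G.ρ i x) = wordInv G l (G.ρ i x) := by
      have h1 : wordInv G (i :: u) x = wordInv G (i :: l) x := hu.wordInv_eq.symm.trans h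
      calc wordInv G u (G.ρ i x)
          = wordInv G (i :: u) x * reflEnd G x i := by
            rw [wordInv, mul_assoc, reflEnd_mul_self, mul_one]
        _ = wordInv G l (G.ρ i x) := by
            rw [h1, wordInv, mul_assoc, reflEnd_mul_self, mul_one]
    rw [hu.nW_eq, nW_cons, nW_cons,
      ih (isReducedWord_cons.1 (hu.isReducedWord hw)).1 (isReducedWord_cons.1 hw').1 hlin]

lemma eN_mul_nW_cons (i : Fin θ) (l : List (Fin θ)) (x : X) :
    eN G R 𝕂 x * nW G R 𝕂 (i :: l) x =
      nN G R 𝕂 x i * (eN G R 𝕂 (G.ρ i x) * nW G R 𝕂 l (G.ρ i x)) := by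
  rw [nW_cons, ← mul_assoc, eN_mul_nN, ← mul_assoc, nN_mul_eN]

variable (G R 𝕂) in
/-- The span of the elements of the nil-Hecke algebra attached to reduced words. -/
def reducedSpan : Submodule 𝕂 (NH G R 𝕂) :=
  Submodule.span 𝕂 {a | ∃ w x, IsReducedWord R w x ∧ a = eN G R 𝕂 x * nW G R 𝕂 w x}

lemma eN_mul_mem_reducedSpan (x : X) {a : NH G R 𝕂} (ha : a ∈ reducedSpan G R 𝕂) :
    eN G R 𝕂 x * a ∈ reducedSpan G R 𝕂 := by
  induction ha using Submodule.span_induction with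
  | mem a ha =>
    obtain ⟨w, y, hw, rfl⟩ := ha
    rw [← mul_assoc]
    by_cases hxy : x = y
    · subst hxy
      rw [eN_mul_eN_self]
      exact Submodule.subset_span ⟨w, x, hw, rfl⟩
    · rw [eN_mul_eN_of_ne hxy, zero_mul]
      exact zero_mem _
  | zero => rw [mul_zero]; exact zero_mem _
  | add a b _ _ ha hb => rw [mul_add]; exact add_mem ha hb
  | smul c a _ ha => rw [mul_smul_comm]; exact Submodule.smul_mem _ c ha

lemma nN_mul_mem_reducedSpan (x : X) (i : Fin θ) {a : NH G R 𝕂} (ha : a ∈ reducedSpan G R 𝕂) :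
    nN G R 𝕂 x i * a ∈ reducedSpan G R 𝕂 := by
  induction ha using Submodule.span_induction with
  | mem a ha =>
    obtain ⟨w, y, hw, rfl⟩ := ha
    by_cases hxy : G.ρ i x = y
    · subst hxy
      by_cases hpos : 0 ≤ wordInv G w (G.ρ i x) (al θ i)
      · exact Submodule.subset_span
          ⟨i :: w, x, isReducedWord_cons.2 ⟨hw, hpos⟩, (eN_mul_nW_cons i w x).symm⟩
      · obtain ⟨u, hu⟩ := exists_wordEquiv_cons R 𝕂 hw hpos
        rw [← mul_assoc, nN_mul_eN, hu.nW_eq, nW_cons, ← mul_assoc, nN_mul_nN, zero_mul]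
        exact zero_mem _
    · rw [← nN_mul_eN, mul_assoc, ← mul_assoc (eN G R 𝕂 _), eN_mul_eN_of_ne hxy, zero_mul, mul_zero]
      exact zero_mem _
  | zero => rw [mul_zero]; exact zero_mem _
  | add a b _ _ ha hb => rw [mul_add]; exact add_mem ha hb
  | smul c a _ ha => rw [mul_smul_comm]; exact Submodule.smul_mem _ c ha

theorem reducedSpan_eq_top : reducedSpan G R 𝕂 = ⊤ := by
  rw [eq_top_iff]
  rintro a -
  obtain ⟨p, hp⟩ := RingQuot.mkAlgHom_surjective 𝕂 (nrel G R 𝕂) a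
  have hone : (1 : NH G R 𝕂) ∈ reducedSpan G R 𝕂 := by
    rw [← sum_eN]
    refine sum_mem fun x _ => Submodule.subset_span ⟨[], x, isReducedWord_nil x, ?_⟩
    rw [nW_nil, mul_one]
  let π : FreeAlgebra 𝕂 (X ⊕ X × Fin θ) →ₐ[𝕂] NH G R 𝕂 := RingQuot.mkAlgHom 𝕂 (nrel G R 𝕂)
  have key : ∀ p, ∀ b ∈ reducedSpan G R 𝕂, π p * b ∈ reducedSpan G R 𝕂 := by
    intro p
    induction p using FreeAlgebra.induction with
    | grade0 c =>
      intro b hb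
      rw [AlgHom.commutes, ← Algebra.smul_def]
      exact Submodule.smul_mem _ c hb
    | grade1 g =>
      intro b hb
      rcases g with x | ⟨x, i⟩
      · exact eN_mul_mem_reducedSpan x hb
      · exact nN_mul_mem_reducedSpan x i hb
    | mul p q hp hq =>
      intro b hb
      rw [map_mul, mul_assoc]
      exact hp _ (hq _ hb)
    | add p q hp hq =>
      intro b hb
      rw [map_add, add_mul]
      exact add_mem (hp _ hb) (hq _ hb)
  have h := key p 1 hone
  rw [mul_one] at h
  rw [← hp]
  exact h

end Matsumoto

section Length

variable {θ : ℕ} {X : Type} [Fintype X] [DecidableEq X] (G : SCG θ X) (R : GRS G)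

/-- The representation of the free category on the generating arrows by reflections. -/
def pathFunctor : Paths (Obj G) ⥤ SingleObj (Module.End ℤ (Fin θ → ℤ))ᵐᵒᵖ :=
  Paths.lift
    { obj := fun _ => SingleObj.star _
      map := fun {_ b} f => (MulOpposite.op (reflEnd G b f.1) : (Module.End ℤ (Fin θ → ℤ))ᵐᵒᵖ) }

variable {G} in
/-- The linear map attached to a path. -/
def pathEnd {a b : X} (p : pob G a ⟶ pob G b) : Module.End ℤ (Fin θ → ℤ) :=
  MulOpposite.unop (show (Module.End ℤ (Fin θ → ℤ))ᵐᵒᵖ from (pathFunctor G).map p)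

variable {G}

lemma pathEnd_pathOf (w : List (Fin θ)) (x : X) : pathEnd (pathOf G w x) = wordInv G w x := by
  induction w generalizing x with
  | nil => rfl
  | cons i l ih => rw [wordInv, ← ih]; rfl

lemma pathEnd_castSrc {a b c : X} (h : a = b) (p : pob G a ⟶ pob G c) :
    pathEnd (castSrc G h p) = pathEnd p := by
  subst h; rfl

variable (G) in
/-- The representation of the Weyl groupoid by products of reflections. -/
def weylFunctor : W G R ⥤ SingleObj (Module.End ℤ (Fin θ → ℤ))ᵐᵒᵖ :=
  CategoryTheory.Quotient.lift (wrel G R) (pathFunctor G) (by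
    rintro _ _ _ _ ⟨x, i, j, h⟩
    have h1 : pathEnd (castSrc G h (pathOf G (altWord i j (2 * mnum G R x i j)) x)) =
        pathEnd (𝟙 (pob G x)) := by
      rw [pathEnd_castSrc, pathEnd_pathOf, wordInv_altWord_loop]; rfl
    exact MulOpposite.unop_injective h1)

variable {R}

/-- The linear map attached to a morphism of the Weyl groupoid. -/
def homEnd {y x : X} (f : homW G R y x) : Module.End ℤ (Fin θ → ℤ) :=
  MulOpposite.unop (show (Module.End ℤ (Fin θ → ℤ))ᵐᵒᵖ from (weylFunctor G R).map f)

lemma homEnd_morW (w : List (Fin θ)) (x : X) : homEnd (morW G R w x) = wordInv G w x :=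
  pathEnd_pathOf w x

lemma homEnd_castW {a b c : X} (h : a = b) (f : homW G R a c) :
    homEnd (castW G R h f) = homEnd f := by
  subst h; rfl

lemma IsReducedWord.len_morW {w : List (Fin θ)} {x : X} (hw : IsReducedWord R w x) :
    len G R (morW G R w x) = w.length := by
  refine le_antisymm (Nat.sInf_le ⟨w, rfl, rfl, rfl⟩) ?_
  refine le_csInf ⟨_, w, rfl, rfl, rfl⟩ ?_
  rintro _ ⟨w', rfl, h, hf⟩
  have h1 : wordInv G w' x = wordInv G w x := by
    rw [← homEnd_morW (R := R), ← homEnd_morW (R := R), ← hf, homEnd_castW]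
  have h2 := encard_inversions_le (R := R) w' x
  rw [h1, hw] at h2
  exact_mod_cast h2

variable (G R) in
/-- The morphism attached to a word, as an element of the set of all morphisms. -/
def wordMor (w : List (Fin θ)) (x : X) : Mor G R := ⟨wsrc G w x, x, morW G R w x⟩

variable (G R) in
/-- The identity morphism of an object, as an element of the set of all morphisms. -/
def idMor (y : X) : Mor G R := ⟨y, y, 𝟙 (objW G R y)⟩

lemma wordInv_eq_of_wordMor_eq {w w' : List (Fin θ)} {x x' : X}
    (h : wordMor G R w x = wordMor G R w' x') : wordInv G w x = wordInv G w' x' := by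
  rw [← homEnd_morW (R := R), ← homEnd_morW (R := R)]
  exact congrArg (fun m : Mor G R => homEnd m.2.2) h

variable {𝕂 : Type} [CommRing 𝕂]

lemma Emap_single (x : X) (m : Mor G R) :
    Emap G R 𝕂 x (Finsupp.single m 1) = if m.2.1 = x then Finsupp.single m 1 else 0 := by
  simp [Emap]

lemma Lmap_single (x : X) (i : Fin θ) (m : Mor G R) :
    Lmap G R 𝕂 x i (Finsupp.single m 1) = Lval G R 𝕂 x i m := by
  simp [Lmap]

lemma Lval_wordMor {i : Fin θ} {l : List (Fin θ)} {x : X} (h : IsReducedWord R (i :: l) x) :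
    Lval G R 𝕂 x i (wordMor G R l (G.ρ i x)) = Finsupp.single (wordMor G R (i :: l) x) 1 := by
  have hlen : len G R (morW G R l (G.ρ i x)) < len G R (morW G R (i :: l) x) := by
    rw [h.len_morW, (isReducedWord_cons.1 h).1.len_morW]
    simp
  exact (dif_pos rfl).trans (if_pos hlen)

lemma map_eN_mul_nW_apply {Λ : NH G R 𝕂 →ₐ[𝕂] Module.End 𝕂 (KW G R 𝕂)}
    (hΛe : ∀ x : X, Λ (eN G R 𝕂 x) = Emap G R 𝕂 x)
    (hΛn : ∀ (x : X) (i : Fin θ), Λ (nN G R 𝕂 x i) = Lmap G R 𝕂 x i)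
    {w : List (Fin θ)} {x : X} (hw : IsReducedWord R w x) (y : X) :
    Λ (eN G R 𝕂 x * nW G R 𝕂 w x) (Finsupp.single (idMor G R y) 1) =
      if y = wsrc G w x then Finsupp.single (wordMor G R w x) 1 else 0 := by
  induction w generalizing x with
  | nil =>
    rw [nW_nil, mul_one, hΛe, Emap_single]
    by_cases h : y = x
    · subst h; rfl
    · exact (if_neg h).trans (if_neg h).symm
  | cons i l ih =>
    rw [eN_mul_nW_cons, map_mul, Module.End.mul_apply, ih (isReducedWord_cons.1 hw).1, hΛn]
    by_cases h : y = wsrc G l (G.ρ i x)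
    · rw [if_pos h, Lmap_single, Lval_wordMor hw]
      exact (if_pos h).symm
    · rw [if_neg h, map_zero]
      exact (if_neg h).symm

variable (G R 𝕂) in
/-- The linear map sending a morphism with a reduced word to the corresponding element of the
nil-Hecke algebra. -/
def ofMor : KW G R 𝕂 →ₗ[𝕂] NH G R 𝕂 := by
  classical
  exact Finsupp.lift (NH G R 𝕂) 𝕂 (Mor G R) fun m =>
    if h : ∃ p : List (Fin θ) × X, IsReducedWord R p.1 p.2 ∧ wordMor G R p.1 p.2 = m then
      eN G R 𝕂 h.choose.2 * nW G R 𝕂 h.choose.1 h.choose.2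
    else 0

lemma ofMor_single_wordMor {w : List (Fin θ)} {x : X} (hw : IsReducedWord R w x) :
    ofMor G R 𝕂 (Finsupp.single (wordMor G R w x) 1) = eN G R 𝕂 x * nW G R 𝕂 w x := by
  classical
  have h : ∃ p : List (Fin θ) × X,
      IsReducedWord R p.1 p.2 ∧ wordMor G R p.1 p.2 = wordMor G R w x := ⟨(w, x), hw, rfl⟩
  have h1 : ofMor G R 𝕂 (Finsupp.single (wordMor G R w x) 1) =
      eN G R 𝕂 h.choose.2 * nW G R 𝕂 h.choose.1 h.choose.2 := by
    rw [ofMor, Finsupp.lift_apply]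
    refine (Finsupp.sum_single_index ?_).trans ?_
    · exact zero_smul 𝕂 _
    · rw [one_smul]
      exact dif_pos h
  rw [h1]
  obtain ⟨hred, heq⟩ := h.choose_spec
  have hx : h.choose.2 = x := congrArg (fun m : Mor G R => m.2.1) heq
  have hlin := wordInv_eq_of_wordMor_eq heq
  rw [hx] at hred hlin ⊢
  rw [nW_eq_of_wordInv_eq hred hw hlin]

end Length

/-- **Faithfulness of the representation `Λ : 𝒩 → End_𝕂(𝕂𝒲)`.**
The representation of the nil-Hecke algebra determined by `Λ(e^x) = E^x` and
`Λ(n_i^x) = L_i^x` is faithful, i.e. `Λ` is injective. -/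
theorem nilHecke_representation_faithful {θ : ℕ} {X : Type} [Fintype X] [DecidableEq X]
    (G : SCG θ X) (R : GRS G) (𝕂 : Type) [CommRing 𝕂]
    (Λ : NH G R 𝕂 →ₐ[𝕂] Module.End 𝕂 (KW G R 𝕂))
    (hΛe : ∀ x : X, Λ (eN G R 𝕂 x) = Emap G R 𝕂 x)
    (hΛn : ∀ (x : X) (i : Fin θ), Λ (nN G R 𝕂 x i) = Lmap G R 𝕂 x i) :
    Function.Injective Λ := by
  have key : ∀ a : NH G R 𝕂,
      ofMor G R 𝕂 (∑ y, Λ a (Finsupp.single (idMor G R y) 1)) = a := by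
    intro a
    have ha : a ∈ reducedSpan G R 𝕂 := by
      rw [reducedSpan_eq_top]; exact Submodule.mem_top
    induction ha using Submodule.span_induction with
    | mem a ha =>
      obtain ⟨w, x, hw, rfl⟩ := ha
      simp only [map_eN_mul_nW_apply hΛe hΛn hw, Finset.sum_ite_eq', Finset.mem_univ, if_true]
      exact ofMor_single_wordMor hw
    | zero => simp
    | add a b _ _ ha hb =>
      simp only [map_add, LinearMap.add_apply, Finset.sum_add_distrib, ha, hb]
    | smul c a _ ha =>
      simp only [map_smul, LinearMap.smul_apply, ← Finset.smul_sum, ha]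
  intro a b hab
  rw [← key a, ← key b, hab]

end WeylGroupoid
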